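/- arXiv:2605.12539 — 4 statements merged into one kernel-verified Lean document; each statement's English description precedes it below -/
import Mathlib

section
/- Let G be a group acting on a set M such that the action is oligomorphic, i.e. for every k the componentwise action of G on (Fin k → M) has only finitely many orbits. Then for every n ≥ 1 the componentwise action of G on (Fin n → M) is also oligomorphic: for every k the componentwise action of G on (Fin k → (Fin n → M)) has only finitely many orbits. -/
/-- If `G` has finitely many orbits on `X`, it has finitely many orbits on every equivariant
image of `X`. -/
theorem finite_orbitRel_quotient_of_surjective {G X Y : Type*} [Group G] [MulAction G X]
    [MulAction G Y] [Finite (MulAction.orbitRel.Quotient G X)] (f : X →[G] Y)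
    (hf : Function.Surjective f) : Finite (MulAction.orbitRel.Quotient G Y) := by
  have hrel : ∀ a b : X, MulAction.orbitRel G X a b → MulAction.orbitRel G Y (f a) (f b) := by
    rintro _ b ⟨g, rfl⟩
    exact ⟨g, (map_smul f g b).symm⟩
  refine Finite.of_surjective
    (Quotient.map f hrel : MulAction.orbitRel.Quotient G X → MulAction.orbitRel.Quotient G Y) ?_
  rintro ⟨y⟩
  obtain ⟨x, rfl⟩ := hf y
  exact ⟨Quotient.mk _ x, rfl⟩

/-- **Proposition 7, first part (orbit form).** If a group `G` acts oligomorphically on `M`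
(finitely many orbits on `k`-tuples for each `k`), then for every `n ≥ 1` the componentwise
action of `G` on `Fin n → M` is also oligomorphic. -/
theorem oligomorphic_power {G M : Type*} [Group G] [MulAction G M]
    (h : ∀ k : ℕ, Finite (MulAction.orbitRel.Quotient G (Fin k → M))) :
    ∀ n : ℕ, 1 ≤ n → ∀ k : ℕ,
      Finite (MulAction.orbitRel.Quotient G (Fin k → (Fin n → M))) := by
  intro n _ k
  have := h (k * n)
  let f : (Fin (k * n) → M) →[G] (Fin k → Fin n → M) :=
    { toFun := fun a i j => a (finProdFinEquiv (i, j))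
      map_smul' := fun _ _ => rfl }
  refine finite_orbitRel_quotient_of_surjective f fun b => ?_
  refine ⟨fun m => b (finProdFinEquiv.symm m).1 (finProdFinEquiv.symm m).2, ?_⟩
  funext i j
  change b (finProdFinEquiv.symm (finProdFinEquiv (i, j))).1
    (finProdFinEquiv.symm (finProdFinEquiv (i, j))).2 = b i j
  rw [Equiv.symm_apply_apply]
end

section
/- Let G be a group acting on a set M, fix m and a tuple c : Fin m → M, and let H = {g ∈ G | ∀ i, g • (c i) = c i} be the pointwise stabilizer of c. For every k and all tuples a, b : Fin k → M: a and b lie in the same H-orbit of (Fin k → M) if and only if the appended tuples Fin.append a c and Fin.append b c lie in the same G-orbit of (Fin (k + m) → M). Consequently the map sending the H-orbit of a to the G-orbit of Fin.append a c is a well-defined injection from the H-orbits on (Fin k → M) into the G-orbits on (Fin (k + m) → M). -/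
/-- The pointwise stabilizer of a tuple `c : Fin m → M`, as a subgroup of `G`. -/
def pointwiseStabilizer (G : Type*) {M : Type*} [Group G] [MulAction G M]
    {m : ℕ} (c : Fin m → M) : Subgroup G where
  carrier := {g : G | ∀ i, g • c i = c i}
  one_mem' := by intro i; simp
  mul_mem' := by
    intro a b ha hb i
    rw [mul_smul, hb i, ha i]
  inv_mem' := by
    intro a ha i
    rw [inv_smul_eq_iff, ha i]

theorem mem_pointwiseStabilizer_iff {G M : Type*} [Group G] [MulAction G M] {m : ℕ}
    {c : Fin m → M} {g : G} : g ∈ pointwiseStabilizer G c ↔ ∀ i, g • c i = c i :=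
  Iff.rfl

theorem Fin.smul_append {G M : Type*} [SMul G M] {k m : ℕ} (g : G)
    (a : Fin k → M) (c : Fin m → M) :
    g • Fin.append a c = Fin.append (g • a) (g • c) := by
  ext i
  refine Fin.addCases (fun i => ?_) (fun i => ?_) i <;> simp

theorem mem_orbit_pointwiseStabilizer_iff {G M : Type*} [Group G] [MulAction G M] {k m : ℕ}
    {c : Fin m → M} {a b : Fin k → M} :
    a ∈ MulAction.orbit (pointwiseStabilizer G c) b ↔
      Fin.append a c ∈ MulAction.orbit G (Fin.append b c) := by
  constructor
  · rintro ⟨⟨g, hg⟩, rfl⟩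
    refine ⟨g, ?_⟩
    have hc : g • c = c := funext hg
    change g • Fin.append b c = Fin.append (g • b) c
    rw [Fin.smul_append, hc]
  · rintro ⟨g, hg⟩
    have hg' : Fin.append (g • b) (g • c) = Fin.append a c :=
      (Fin.smul_append g b c).symm.trans hg
    refine ⟨⟨g, mem_pointwiseStabilizer_iff.2 fun i => ?_⟩, ?_⟩
    · simpa using congrFun hg' (Fin.natAdd k i)
    · ext i
      simpa using congrFun hg' (Fin.castAdd m i)

/-- **Types of an expansion by constants (orbit form).** Two `k`-tuples lie in the same
orbit of the pointwise stabilizer `H` of `c` iff their concatenations with `c` lie in the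
same `G`-orbit; consequently `H`-orbits of `k`-tuples inject into `G`-orbits of
`(k + m)`-tuples via appending `c`. -/
theorem pointwiseStabilizer_orbit_iff_append_orbit
    {G M : Type*} [Group G] [MulAction G M] {m : ℕ} (c : Fin m → M) (k : ℕ) :
    (∀ a b : Fin k → M,
      a ∈ MulAction.orbit (pointwiseStabilizer G c) b ↔
        Fin.append a c ∈ MulAction.orbit G (Fin.append b c)) ∧
    ∃ F : MulAction.orbitRel.Quotient (pointwiseStabilizer G c) (Fin k → M) →
          MulAction.orbitRel.Quotient G (Fin (k + m) → M),
      Function.Injective F ∧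
      ∀ a : Fin k → M,
        F (Quotient.mk (MulAction.orbitRel (pointwiseStabilizer G c) (Fin k → M)) a) =
          Quotient.mk (MulAction.orbitRel G (Fin (k + m) → M)) (Fin.append a c) := by
  refine ⟨fun a b => mem_orbit_pointwiseStabilizer_iff,
    Quotient.map (fun a => Fin.append a c) fun a b => mem_orbit_pointwiseStabilizer_iff.1,
    ?_, fun a => rfl⟩
  rintro ⟨a⟩ ⟨b⟩ h
  exact Quotient.sound (mem_orbit_pointwiseStabilizer_iff.2 (Quotient.exact h))
end

section
/- Let L be a first-order language, T an L-theory, and k ∈ ℕ. If the set of complete types of T over Fin k is finite, then every complete type p of T over Fin k is isolated: there exists a sentence θ of L[[Fin k]] with θ ∈ p such that every complete type q of T over Fin k with θ ∈ q satisfies q = p. -/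
open FirstOrder FirstOrder.Language

namespace FirstOrder.Language.Theory.CompleteType

theorem exists_mem_notMem_of_ne {L : Language} {T : L.Theory} {α : Type*}
    {p q : T.CompleteType α} (h : q ≠ p) :
    ∃ φ : (L[[α]]).Sentence, φ ∈ p ∧ φ ∉ q := by
  by_contra! hle
  refine h (SetLike.ext fun φ => ⟨fun hq => ?_, hle φ⟩)
  by_contra hp
  exact (q.not_mem_iff φ).1 (hle _ ((p.not_mem_iff φ).2 hp)) hq

end FirstOrder.Language.Theory.CompleteType

/-- **Ryll-Nardzewski, (2) ⇒ (3).** If a theory `T` has only finitely many complete types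
over `Fin k`, then every complete type over `Fin k` is isolated by some sentence. -/
theorem isolated_of_finite_completeTypes {L : Language} (T : L.Theory) (k : ℕ)
    (hfin : Finite (T.CompleteType (Fin k))) :
    ∀ p : T.CompleteType (Fin k),
      ∃ θ : (L[[Fin k]]).Sentence, θ ∈ p ∧
        ∀ q : T.CompleteType (Fin k), θ ∈ q → q = p := by
  classical
  intro p
  have := Fintype.ofFinite (T.CompleteType (Fin k))
  choose φ hp hq using fun q : {q : T.CompleteType (Fin k) // q ≠ p} =>
    Theory.CompleteType.exists_mem_notMem_of_ne q.2
  refine ⟨(Finset.univ.image φ).toList.foldr (· ⊓ ·) ⊤,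
    Theory.CompleteType.toList_foldr_inf_mem.2 ?_, fun q hθ => ?_⟩
  · intro ψ hψ
    obtain ⟨q, -, rfl⟩ := Finset.mem_image.1 hψ
    exact hp q
  · by_contra hne
    exact hq ⟨q, hne⟩ (Theory.CompleteType.toList_foldr_inf_mem.1 hθ
      (Finset.mem_image_of_mem φ (Finset.mem_univ _)))
end

section
/- Let L be a first-order language, T an L-theory, and k ∈ ℕ. Suppose every complete type p of T over Fin k is isolated, i.e. for each such p there exists a sentence θ of L[[Fin k]] with θ ∈ p such that every complete type of T over Fin k containing θ equals p. Then the set of complete types of T over Fin k is finite. -/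
open FirstOrder FirstOrder.Language

/-- **Ryll-Nardzewski, (3) ⇒ (2).** If every complete type of `T` over `Fin k` is isolated
by some sentence, then there are only finitely many complete types of `T` over `Fin k`. -/
theorem finite_completeTypes_of_isolated {L : Language} (T : L.Theory) (k : ℕ)
    (hiso : ∀ p : T.CompleteType (Fin k),
      ∃ θ : (L[[Fin k]]).Sentence, θ ∈ p ∧
        ∀ q : T.CompleteType (Fin k), θ ∈ q → q = p) :
    Finite (T.CompleteType (Fin k)) := by
  have : DiscreteTopology (T.CompleteType (Fin k)) := by
    refine discreteTopology_iff_isOpen_singleton.mpr fun p ↦ ?_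
    obtain ⟨θ, hθ, hp⟩ := hiso p
    convert CompleteType.isOpen_typesWith (T := T) θ using 1
    ext q
    exact ⟨by rintro rfl; exact hθ, hp q⟩
  exact finite_of_compact_of_discrete
end
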